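/- Let n ≥ 1 be an integer, N = dim Π_n^q, C ⊂ S^q a finite set, and ν a measure supported on C with masses v_ξ := ν({ξ}). Assume c₁ ‖P‖_{L^p(μ_q)} ≤ (Σ_{ξ∈C} v_ξ |P(ξ)|^p)^{1/p} ≤ c₂ ‖P‖_{L^p(μ_q)} for all P ∈ Π_n^q and all 1 ≤ p ≤ ∞ (sup norm for p = ∞). Then: (i) every eigenvalue of the Gram matrix G_N lies in the interval [c₁², c₂²], where c₁, c₂ are the constants for p = 2; in particular G_N is positive definite; and (ii) Σ_{ξ∈C} |w_ξ^{LSQ}| ≤ c, where c depends only on q, c₁, c₂. -/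

import Mathlib

noncomputable section

open MeasureTheory Finset

namespace SD

/-- Euclidean space `ℝ^(q+1)`. -/
abbrev Euc (q : ℕ) := EuclideanSpace ℝ (Fin (q + 1))

/-- The unit sphere `S^q ⊂ ℝ^(q+1)`, as a type. -/
abbrev Sph (q : ℕ) : Type := Metric.sphere (0 : Euc q) 1

/-- Dot product of two points of the sphere. -/
def dot {q : ℕ} (x y : Sph q) : ℝ := ∑ i, (x : Euc q) i * (y : Euc q) i

/-- Geodesic distance `arccos (x ⬝ y)` on the sphere. -/
def gdist {q : ℕ} (x y : Sph q) : ℝ := Real.arccos (dot x y)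

/-- The mesh norm `δ_C(S^q)` of a finite set of points. -/
def meshNorm {q : ℕ} (C : Finset (Sph q)) : ℝ :=
  ⨆ x : Sph q, sInf ((fun ξ => gdist x ξ) '' (C : Set (Sph q)))

/-- `f : S^q → ℝ` belongs to `Π_n^q` : it is the restriction to the sphere of an algebraic
polynomial in `q+1` variables of total degree at most `n`. -/
def InPi (q n : ℕ) (f : Sph q → ℝ) : Prop :=
  ∃ P : MvPolynomial (Fin (q + 1)) ℝ, P.totalDegree ≤ n ∧
    ∀ x : Sph q, f x = MvPolynomial.eval (fun i => (x : Euc q) i) P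

/-- `f` is a spherical harmonic of degree `ℓ` : the restriction to the sphere of a
homogeneous harmonic polynomial of degree `ℓ`. -/
def IsSphHarm (q ℓ : ℕ) (f : Sph q → ℝ) : Prop :=
  ∃ P : MvPolynomial (Fin (q + 1)) ℝ, P.IsHomogeneous ℓ ∧
    (∑ i : Fin (q + 1), MvPolynomial.pderiv i (MvPolynomial.pderiv i P)) = 0 ∧
    ∀ x : Sph q, f x = MvPolynomial.eval (fun i => (x : Euc q) i) P

/-- Rotation of a point of the sphere by a linear isometry of the ambient space. -/
def rotate {q : ℕ} (R : Euc q ≃ₗᵢ[ℝ] Euc q) (x : Sph q) : Sph q :=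
  ⟨R x, by
    have hx : ‖(x : Euc q)‖ = 1 := mem_sphere_zero_iff_norm.mp x.2
    simp [mem_sphere_zero_iff_norm, hx]⟩

/-- `μ` is invariant under all rotations of the sphere. -/
def RotInvariant (q : ℕ) (μ : Measure (Sph q)) : Prop :=
  ∀ R : Euc q ≃ₗᵢ[ℝ] Euc q, Measure.map (rotate R) μ = μ

/-- `IterIntBV S f` : `f` is an `S` times iterated integral of a function of bounded
variation (on `[0,∞)`). -/
def IterIntBV : ℕ → (ℝ → ℝ) → Prop
  | 0, f => BoundedVariationOn f (Set.Ici 0)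
  | (S + 1), f => ∃ g : ℝ → ℝ, IterIntBV S g ∧ ∀ x : ℝ, 0 ≤ x → f x = f 0 + ∫ t in (0 : ℝ)..x, g t

/-- The standing hypotheses on the filter function `h` : `h = 1` on `[0,1/2]`, `h = 0` on
`(1,∞)`, `h` nonincreasing on `[0,∞)`, and `h` an `S` times iterated integral of a function
of bounded variation. -/
def GoodH (S : ℕ) (h : ℝ → ℝ) : Prop :=
  (∀ x : ℝ, 0 ≤ x → x ≤ 1 / 2 → h x = 1) ∧
  (∀ x : ℝ, 1 < x → h x = 0) ∧
  (∀ x y : ℝ, 0 ≤ x → x ≤ y → h y ≤ h x) ∧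
  IterIntBV S h

/-- `Y ℓ ·` is, for each `ℓ`, an orthonormal basis of the space of degree `ℓ` spherical
harmonics in `L²(μ)`. -/
def GoodBasis (q : ℕ) (μ : Measure (Sph q)) (d : ℕ → ℕ)
    (Y : (ℓ : ℕ) → Fin (d ℓ) → Sph q → ℝ) : Prop :=
  (∀ ℓ k, IsSphHarm q ℓ (Y ℓ k)) ∧
  (∀ (ℓ ℓ' : ℕ) (k : Fin (d ℓ)) (k' : Fin (d ℓ')),
      ∫ x, Y ℓ k x * Y ℓ' k' x ∂μ = if ℓ = ℓ' ∧ (k : ℕ) = (k' : ℕ) then 1 else 0) ∧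
  (∀ (ℓ : ℕ) (f : Sph q → ℝ), IsSphHarm q ℓ f →
      ∃ a : Fin (d ℓ) → ℝ, ∀ x, f x = ∑ k, a k * Y ℓ k x)

/-- The kernel `Φ_n(h; x·ξ) = Σ_{ℓ=0}^n h(ℓ/n) Σ_k Y_{ℓ,k}(x) Y_{ℓ,k}(ξ)`. -/
def Phi {q : ℕ} (d : ℕ → ℕ) (Y : (ℓ : ℕ) → Fin (d ℓ) → Sph q → ℝ) (h : ℝ → ℝ) (n : ℕ)
    (x ξ : Sph q) : ℝ :=
  ∑ ℓ ∈ range (n + 1), h ((ℓ : ℝ) / (n : ℝ)) * ∑ k, Y ℓ k x * Y ℓ k ξ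

/-- The discretized operator `σ_n(C, W; h; Z, x) = Σ_{ξ∈C} w_ξ z_ξ Φ_n(h; x·ξ)`. -/
def sigmaOp {q : ℕ} (d : ℕ → ℕ) (Y : (ℓ : ℕ) → Fin (d ℓ) → Sph q → ℝ) (h : ℝ → ℝ) (n : ℕ)
    (C : Finset (Sph q)) (w : Sph q → ℝ) (z : Sph q → ℝ) (x : Sph q) : ℝ :=
  ∑ ξ ∈ C, w ξ * z ξ * Phi d Y h n x ξ

/-- The summability operator `σ*_n(h; f, x) = ∫ f(ζ) Φ_n(h; x·ζ) dμ(ζ)`. -/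
def sigmaStar {q : ℕ} (μ : Measure (Sph q)) (d : ℕ → ℕ)
    (Y : (ℓ : ℕ) → Fin (d ℓ) → Sph q → ℝ) (h : ℝ → ℝ) (n : ℕ) (f : Sph q → ℝ)
    (x : Sph q) : ℝ :=
  ∫ ζ, f ζ * Phi d Y h n x ζ ∂μ

/-- Sup norm on the sphere. -/
def supNorm {q : ℕ} (f : Sph q → ℝ) : ℝ := ⨆ x : Sph q, |f x|

/-- Sup norm on a subset of the sphere. -/
def supNormOn {q : ℕ} (K : Set (Sph q)) (f : Sph q → ℝ) : ℝ := ⨆ x ∈ K, |f x|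

/-- The spherical cap of radius `δ` centered at `x₀`. -/
def cap {q : ℕ} (x₀ : Sph q) (δ : ℝ) : Set (Sph q) := {x | gdist x x₀ ≤ δ}

/-- `C` admits a Marcinkiewicz–Zygmund quadrature of order `m` with weights `w` and
M–Z constant `c₀`. -/
def MZQuad (q : ℕ) (μ : Measure (Sph q)) (m : ℕ) (C : Finset (Sph q)) (w : Sph q → ℝ)
    (c₀ : ℝ) : Prop :=
  (∀ P : Sph q → ℝ, InPi q (2 * m) P → ∑ ξ ∈ C, w ξ * P ξ = ∫ x, P x ∂μ) ∧
  (∀ P : Sph q → ℝ, InPi q (2 * m) P → ∀ p : ℝ, 1 ≤ p →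
      (∑ ξ ∈ C, |w ξ| * |P ξ| ^ p) ^ (1 / p) ≤ c₀ * (∫ x, |P x| ^ p ∂μ) ^ (1 / p))

/-- The sequence `n ↦ 2^((n+1)r) ‖σ*_{2^(n+1)}(h;f) − σ*_{2^n}(h;f)‖_{∞,K}`. -/
def WrSeqOn {q : ℕ} (K : Set (Sph q)) (μ : Measure (Sph q)) (d : ℕ → ℕ)
    (Y : (ℓ : ℕ) → Fin (d ℓ) → Sph q → ℝ) (h : ℝ → ℝ) (r : ℝ) (f : Sph q → ℝ) (n : ℕ) : ℝ :=
  (2 : ℝ) ^ (((n : ℝ) + 1) * r) *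
    supNormOn K (fun x => sigmaStar μ d Y h (2 ^ (n + 1)) f x - sigmaStar μ d Y h (2 ^ n) f x)

/-- The norm `‖f‖_{W_r(K)}`. -/
def WrNormOn {q : ℕ} (K : Set (Sph q)) (μ : Measure (Sph q)) (d : ℕ → ℕ)
    (Y : (ℓ : ℕ) → Fin (d ℓ) → Sph q → ℝ) (h : ℝ → ℝ) (r : ℝ) (f : Sph q → ℝ) : ℝ :=
  supNorm f + ⨆ n : ℕ, WrSeqOn K μ d Y h r f n

/-- The norm `‖f‖_{W_r}`. -/
def WrNorm {q : ℕ} (μ : Measure (Sph q)) (d : ℕ → ℕ)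
    (Y : (ℓ : ℕ) → Fin (d ℓ) → Sph q → ℝ) (h : ℝ → ℝ) (r : ℝ) (f : Sph q → ℝ) : ℝ :=
  WrNormOn Set.univ μ d Y h r f

/-- Membership in `W_r(K)` : `f` is continuous and the `W_r(K)` seminorm is finite. -/
def MemWrOn {q : ℕ} (K : Set (Sph q)) (μ : Measure (Sph q)) (d : ℕ → ℕ)
    (Y : (ℓ : ℕ) → Fin (d ℓ) → Sph q → ℝ) (h : ℝ → ℝ) (r : ℝ) (f : Sph q → ℝ) : Prop :=
  Continuous f ∧ BddAbove (Set.range (WrSeqOn K μ d Y h r f))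

/-- `y` is an orthonormal basis of `Π_n^q` in `L²(μ)` (so `N = dim Π_n^q`), whose `0`-th
element is the constant polynomial `1`. -/
def GoodPolyBasis (q n N : ℕ) (μ : Measure (Sph q)) (y : Fin N → Sph q → ℝ) : Prop :=
  (∀ i, InPi q n (y i)) ∧
  (∀ i j, ∫ x, y i x * y j x ∂μ = if i = j then 1 else 0) ∧
  (∀ P : Sph q → ℝ, InPi q n P → ∃ a : Fin N → ℝ, ∀ x, P x = ∑ i, a i * y i x) ∧
  (∀ i : Fin N, (i : ℕ) = 0 → ∀ x, y i x = 1)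

/-- The Gram matrix `(G_N)_{i,j} = Σ_{ξ∈C} v_ξ y_i(ξ) y_j(ξ)`. -/
def gram {q N : ℕ} (C : Finset (Sph q)) (v : Sph q → ℝ) (y : Fin N → Sph q → ℝ) :
    Matrix (Fin N) (Fin N) ℝ :=
  Matrix.of fun i j => ∑ ξ ∈ C, v ξ * y i ξ * y j ξ

/-- The least squares quadrature weights `w_ξ^{LSQ} = v_ξ Σ_k (G_N⁻¹)_{i₀,k} y_k(ξ)`. -/
def wLSQ {q N : ℕ} (C : Finset (Sph q)) (v : Sph q → ℝ) (y : Fin N → Sph q → ℝ) (i0 : Fin N)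
    (ξ : Sph q) : ℝ :=
  v ξ * ∑ k, (gram C v y)⁻¹ i0 k * y k ξ

/-- Two–sided Marcinkiewicz–Zygmund inequalities for the masses `v` on `C`, for all
`1 ≤ p ≤ ∞`. -/
def VMZ (q n : ℕ) (μ : Measure (Sph q)) (C : Finset (Sph q)) (v : Sph q → ℝ)
    (c₁ c₂ : ℝ) : Prop :=
  (∀ P : Sph q → ℝ, InPi q n P → ∀ p : ℝ, 1 ≤ p →
      c₁ * (∫ x, |P x| ^ p ∂μ) ^ (1 / p) ≤ (∑ ξ ∈ C, v ξ * |P ξ| ^ p) ^ (1 / p) ∧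
      (∑ ξ ∈ C, v ξ * |P ξ| ^ p) ^ (1 / p) ≤ c₂ * (∫ x, |P x| ^ p ∂μ) ^ (1 / p)) ∧
  (∀ P : Sph q → ℝ, InPi q n P →
      c₁ * supNorm P ≤ (⨆ ξ ∈ (C : Set (Sph q)), |P ξ|) ∧
      (⨆ ξ ∈ (C : Set (Sph q)), |P ξ|) ≤ c₂ * supNorm P)


/-- A real linear combination of elements of `Π_n^q` is in `Π_n^q`. -/
theorem InPi.linearCombination {q n N : ℕ} {y : Fin N → Sph q → ℝ} (hy : ∀ i, InPi q n (y i))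
    (a : Fin N → ℝ) : InPi q n (fun x => ∑ i, a i * y i x) := by
  choose P hP hPy using hy
  refine ⟨∑ i, a i • P i, ?_, fun x => ?_⟩
  · exact MvPolynomial.totalDegree_finsetSum_le fun i _ =>
      (MvPolynomial.totalDegree_smul_le _ _).trans (hP i)
  · simp [hPy]

theorem InPi.continuous {q n : ℕ} {f : Sph q → ℝ} (hf : InPi q n f) : Continuous f := by
  obtain ⟨P, -, hP⟩ := hf
  rw [funext hP]
  refine (MvPolynomial.continuous_eval P).comp (continuous_pi fun i => ?_)
  exact (EuclideanSpace.proj (𝕜 := ℝ) i).continuous.comp continuous_subtype_val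

theorem integrable_of_continuous_sphere {q : ℕ} (μ : Measure (Sph q)) [IsFiniteMeasure μ]
    {f : Sph q → ℝ} (hf : Continuous f) : Integrable f μ :=
  hf.integrable_of_hasCompactSupport (HasCompactSupport.of_compactSpace f)

/-- Parseval's identity in `Π_n^q`. -/
theorem GoodPolyBasis.integral_sq {q n N : ℕ} {μ : Measure (Sph q)} [IsFiniteMeasure μ]
    {y : Fin N → Sph q → ℝ} (hy : GoodPolyBasis q n N μ y) (a : Fin N → ℝ) :
    ∫ x, (∑ i, a i * y i x) ^ 2 ∂μ = ∑ i, a i ^ 2 := by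
  have hint : ∀ i j, Integrable (fun x => a i * a j * (y i x * y j x)) μ := fun i j =>
    (integrable_of_continuous_sphere μ ((hy.1 i).continuous.mul (hy.1 j).continuous)).const_mul _
  calc ∫ x, (∑ i, a i * y i x) ^ 2 ∂μ
      = ∫ x, ∑ i, ∑ j, a i * a j * (y i x * y j x) ∂μ := by
        refine integral_congr_ae (.of_forall fun x => ?_)
        simp only [sq, Finset.sum_mul_sum]
        exact Finset.sum_congr rfl fun i _ => Finset.sum_congr rfl fun j _ => by ring
    _ = ∑ i, ∑ j, a i * a j * (if i = j then 1 else 0) := by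
        rw [integral_finsetSum _ fun i _ => integrable_finsetSum _ fun j _ => hint i j]
        refine Finset.sum_congr rfl fun i _ => ?_
        rw [integral_finsetSum _ fun j _ => hint i j]
        exact Finset.sum_congr rfl fun j _ => by rw [integral_const_mul, hy.2.1]
    _ = ∑ i, a i ^ 2 := by simp [sq]

/-- The case `p = 2` of the Marcinkiewicz–Zygmund inequalities, without roots. -/
theorem VMZ.sq {q n : ℕ} {μ : Measure (Sph q)} {C : Finset (Sph q)} {v : Sph q → ℝ} {c₁ c₂ : ℝ}
    (h : VMZ q n μ C v c₁ c₂) (hv : ∀ ξ ∈ C, 0 ≤ v ξ) (hc₁ : 0 ≤ c₁)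
    {P : Sph q → ℝ} (hP : InPi q n P) :
    c₁ ^ 2 * ∫ x, P x ^ 2 ∂μ ≤ ∑ ξ ∈ C, v ξ * P ξ ^ 2 ∧
      ∑ ξ ∈ C, v ξ * P ξ ^ 2 ≤ c₂ ^ 2 * ∫ x, P x ^ 2 ∂μ := by
  have hI : 0 ≤ ∫ x, P x ^ 2 ∂μ := integral_nonneg fun x => sq_nonneg _
  have hS : 0 ≤ ∑ ξ ∈ C, v ξ * P ξ ^ 2 :=
    Finset.sum_nonneg fun ξ hξ => mul_nonneg (hv ξ hξ) (sq_nonneg _)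
  have h2 := h.1 P hP 2 one_le_two
  simp only [Real.rpow_two, sq_abs, ← Real.sqrt_eq_rpow] at h2
  constructor
  · have := pow_le_pow_left₀ (by positivity) h2.1 2
    rwa [mul_pow, Real.sq_sqrt hI, Real.sq_sqrt hS] at this
  · have := pow_le_pow_left₀ (by positivity) h2.2 2
    rwa [mul_pow, Real.sq_sqrt hI, Real.sq_sqrt hS] at this

theorem gram_isHermitian {q N : ℕ} (C : Finset (Sph q)) (v : Sph q → ℝ)
    (y : Fin N → Sph q → ℝ) : (gram C v y).IsHermitian := by
  ext i j
  simp only [gram, Matrix.conjTranspose_apply, Matrix.of_apply, star_trivial]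
  exact Finset.sum_congr rfl fun ξ _ => by ring

/-- The quadratic form of the Gram matrix. -/
theorem dotProduct_gram_mulVec {q N : ℕ} (C : Finset (Sph q)) (v : Sph q → ℝ)
    (y : Fin N → Sph q → ℝ) (a : Fin N → ℝ) :
    a ⬝ᵥ (gram C v y).mulVec a = ∑ ξ ∈ C, v ξ * (∑ i, a i * y i ξ) ^ 2 := by
  have hrhs : ∀ ξ ∈ C, v ξ * (∑ i, a i * y i ξ) ^ 2 =
      ∑ i, ∑ j, a i * (v ξ * y i ξ * y j ξ * a j) := fun ξ _ => by
    rw [sq, Finset.sum_mul_sum, Finset.mul_sum]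
    refine Finset.sum_congr rfl fun i _ => ?_
    rw [Finset.mul_sum]
    exact Finset.sum_congr rfl fun j _ => by ring
  rw [Finset.sum_congr rfl hrhs, Finset.sum_comm]
  refine Finset.sum_congr rfl fun i _ => ?_
  rw [Finset.sum_comm]
  simp only [Matrix.mulVec, dotProduct, gram, Matrix.of_apply, Finset.mul_sum, Finset.sum_mul]

/-- Under the two–sided M–Z inequalities, the eigenvalues of the Gram matrix lie in
`[c₁², c₂²]` (in particular it is positive definite), and `Σ_ξ |w_ξ^{LSQ}| ≤ c`. -/
theorem statement10 (q : ℕ) (hq : 1 ≤ q)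
    (μ : Measure (Sph q)) (hμ : IsProbabilityMeasure μ) (hrot : RotInvariant q μ)
    (c₁ c₂ : ℝ) (hc₁ : 0 < c₁) (hc₂ : 0 < c₂) :
    ∃ c : ℝ, 0 < c ∧
      ∀ n N : ℕ, 1 ≤ n → ∀ (hN : 0 < N) (y : Fin N → Sph q → ℝ), GoodPolyBasis q n N μ y →
      ∀ (C : Finset (Sph q)) (v : Sph q → ℝ), (∀ ξ ∈ C, 0 ≤ v ξ) →
        VMZ q n μ C v c₁ c₂ →
        (gram C v y).PosDef ∧
        (∀ (hH : (gram C v y).IsHermitian) (i : Fin N),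
          c₁ ^ 2 ≤ hH.eigenvalues i ∧ hH.eigenvalues i ≤ c₂ ^ 2) ∧
        (∑ ξ ∈ C, |wLSQ C v y ⟨0, hN⟩ ξ|) ≤ c := by
  have := hμ
  refine ⟨c₂ / c₁, by positivity, fun n N _ hN y hy C v hv hMZ => ?_⟩
  have hform (a : Fin N → ℝ) : c₁ ^ 2 * ∑ i, a i ^ 2 ≤ a ⬝ᵥ (gram C v y).mulVec a ∧
      a ⬝ᵥ (gram C v y).mulVec a ≤ c₂ ^ 2 * ∑ i, a i ^ 2 := by
    have := hMZ.sq hv hc₁.le (InPi.linearCombination hy.1 a)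
    rwa [hy.integral_sq, ← dotProduct_gram_mulVec] at this
  have hpos : (gram C v y).PosDef := by
    refine Matrix.PosDef.of_dotProduct_mulVec_pos (gram_isHermitian C v y) fun a ha => ?_
    obtain ⟨i, hi⟩ := Function.ne_iff.1 ha
    refine lt_of_lt_of_le (mul_pos (by positivity) ?_) (hform a).1
    exact Finset.sum_pos' (fun i _ => sq_nonneg _) ⟨i, Finset.mem_univ i, sq_pos_of_ne_zero hi⟩
  refine ⟨hpos, fun hH i => ?_, ?_⟩
  · have hunit : ∑ j, (hH.eigenvectorBasis i) j ^ 2 = 1 := by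
      rw [← EuclideanSpace.real_norm_sq_eq, hH.eigenvectorBasis.norm_eq_one, one_pow]
    have := hform (hH.eigenvectorBasis i)
    rw [hunit, mul_one, mul_one] at this
    rw [hH.eigenvalues_eq]
    simpa using this
  · set b : Fin N → ℝ := (gram C v y)⁻¹ ⟨0, hN⟩ with hb
    have hbG : b ⬝ᵥ (gram C v y).mulVec b = b ⟨0, hN⟩ := by
      have hinv : (gram C v y)⁻¹ * gram C v y = 1 :=
        Matrix.nonsing_inv_mul _ ((Matrix.isUnit_iff_isUnit_det _).1 hpos.isUnit)
      have hrow : Matrix.vecMul b (gram C v y) = Pi.single ⟨0, hN⟩ 1 := by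
        ext j
        rw [hb, ← Matrix.mul_apply_eq_vecMul, hinv]
        simp [Matrix.one_apply, Pi.single_apply, eq_comm]
      rw [Matrix.dotProduct_mulVec, hrow, single_dotProduct, one_mul]
    have hb0 : c₁ ^ 2 * b ⟨0, hN⟩ ^ 2 ≤ b ⟨0, hN⟩ := by
      refine le_trans ?_ ((hform b).1.trans_eq hbG)
      gcongr
      exact Finset.single_le_sum (f := fun i => b i ^ 2) (fun i _ => sq_nonneg _)
        (Finset.mem_univ _)
    have hb1 : ∑ ξ ∈ C, v ξ * (∑ k, b k * y k ξ) ^ 2 ≤ 1 / c₁ ^ 2 := by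
      rw [← dotProduct_gram_mulVec, hbG, le_div_iff₀ (by positivity)]
      by_contra! hlt
      nlinarith [sq_nonneg (b ⟨0, hN⟩), sq_nonneg c₁]
    have hmass : ∑ ξ ∈ C, v ξ ≤ c₂ ^ 2 := by
      have hone : InPi q n fun _ => (1 : ℝ) := ⟨1, by simp, fun x => by simp⟩
      simpa using (hMZ.sq hv hc₁.le hone).2
    refine abs_le_of_sq_le_sq' ?_ (by positivity) |>.2
    calc (∑ ξ ∈ C, |wLSQ C v y ⟨0, hN⟩ ξ|) ^ 2
        ≤ (∑ ξ ∈ C, v ξ) * ∑ ξ ∈ C, v ξ * (∑ k, b k * y k ξ) ^ 2 := by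
          refine Finset.sum_sq_le_sum_mul_sum_of_sq_le_mul C hv
            (fun ξ hξ => mul_nonneg (hv ξ hξ) (sq_nonneg _)) fun ξ _ => Eq.le ?_
          rw [sq_abs, wLSQ]
          ring
      _ ≤ c₂ ^ 2 * (1 / c₁ ^ 2) := by
          gcongr
          exact Finset.sum_nonneg fun ξ hξ => mul_nonneg (hv ξ hξ) (sq_nonneg _)
      _ = (c₂ / c₁) ^ 2 := by ring


end SD
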